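/- Let a ≥ 0, p > 1 and N ≥ 3. If p is Sobolev subcritical, i.e. 1 < p < (N+2+2a)/(N−2), then the Hénon equation −Δu = |x|^a u^p on ℝ^N has no positive solution with finite Morse index; in particular, there is no positive C² solution that is stable outside some compact subset of ℝ^N. -/

import Mathlib

open MeasureTheory Real

/-- The Laplacian of a function on Euclidean space, as the sum of its second
partial derivatives in the coordinate directions. -/
noncomputable def lap {N : ℕ} (f : EuclideanSpace ℝ (Fin N) → ℝ)
    (x : EuclideanSpace ℝ (Fin N)) : ℝ :=
  ∑ i : Fin N,
    fderiv ℝ (fun y => fderiv ℝ f y (EuclideanSpace.single i 1)) x (EuclideanSpace.single i 1)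

/-- Directional derivative along the `i`-th coordinate vector. -/
noncomputable def pd {N : ℕ} (i : Fin N) (f : EuclideanSpace ℝ (Fin N) → ℝ)
    (x : EuclideanSpace ℝ (Fin N)) : ℝ := fderiv ℝ f x (EuclideanSpace.single i 1)

/-- `f` has derivative `d` at `x` in the `i`-th coordinate direction. -/
def HasPD {N : ℕ} (i : Fin N) (f : EuclideanSpace ℝ (Fin N) → ℝ) (d : ℝ)
    (x : EuclideanSpace ℝ (Fin N)) : Prop :=
  HasLineDerivAt ℝ f d x (EuclideanSpace.single i 1)

section helpers
variable {N : ℕ} {i : Fin N} {f g : EuclideanSpace ℝ (Fin N) → ℝ} {d e : ℝ}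
  {x : EuclideanSpace ℝ (Fin N)}

lemma HasPD.mul (hf : HasPD i f d x) (hg : HasPD i g e x) :
    HasPD i (fun y => f y * g y) (d * g x + f x * e) x := by
  have := HasDerivAt.fun_mul hf hg
  simpa [HasPD, HasLineDerivAt] using this

lemma HasPD.add (hf : HasPD i f d x) (hg : HasPD i g e x) :
    HasPD i (fun y => f y + g y) (d + e) x := HasDerivAt.fun_add hf hg

lemma HasPD.sub (hf : HasPD i f d x) (hg : HasPD i g e x) :
    HasPD i (fun y => f y - g y) (d - e) x := HasDerivAt.fun_sub hf hg

lemma HasPD.const_mul (c : ℝ) (hf : HasPD i f d x) :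
    HasPD i (fun y => c * f y) (c * d) x := HasDerivAt.const_mul c hf

lemma HasPD.sum {F : Fin N → EuclideanSpace ℝ (Fin N) → ℝ} {D : Fin N → ℝ}
    (h : ∀ j, HasPD i (F j) (D j) x) :
    HasPD i (fun y => ∑ j, F j y) (∑ j, D j) x :=
  HasDerivAt.fun_sum (fun j _ => h j)

lemma HasPD.coord (j : Fin N) : HasPD i (fun y => y j) (if j = i then 1 else 0) x := by
  have h : HasDerivAt (fun t : ℝ => x j + t * (if j = i then 1 else 0)) (if j = i then 1 else 0) 0 := by
    simpa using ((hasDerivAt_id (0:ℝ)).mul_const (if j = i then (1:ℝ) else 0)).const_add (x j)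
  have e : (fun t : ℝ => (x + t • EuclideanSpace.single i (1:ℝ)) j)
      = fun t : ℝ => x j + t * (if j = i then 1 else 0) := by
    ext t
    by_cases hji : j = i <;> simp [hji]
  unfold HasPD HasLineDerivAt
  rw [e]
  exact h

lemma HasPD.of_diff (hf : DifferentiableAt ℝ f x) : HasPD i f (pd i f x) x :=
  hf.hasFDerivAt.hasLineDerivAt _

lemma HasPD.pd_eq (hf : DifferentiableAt ℝ f x) (h : HasPD i f d x) : pd i f x = d :=
  HasDerivAt.unique (HasPD.of_diff hf) h

lemma contDiff_pd (hf : ContDiff ℝ 2 f) : ContDiff ℝ 1 (pd i f) := by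
  unfold pd
  exact (hf.fderiv_right (by norm_num)).clm_apply contDiff_const

lemma continuous_pd (hf : ContDiff ℝ 1 f) : Continuous (pd i f) := by
  unfold pd
  exact (hf.continuous_fderiv (by norm_num)).clm_apply continuous_const

lemma integral_pd_zero {f' : EuclideanSpace ℝ (Fin N) → ℝ} (hc : Continuous f)
    (hs : HasCompactSupport f) (hd : ∀ x, HasPD i f (f' x) x) (hi : Integrable f') :
    ∫ x, f' x = 0 := by
  have := integral_bilinear_hasLineDerivAt_right_eq_neg_left_of_integrable
    (μ := (volume : Measure (EuclideanSpace ℝ (Fin N))))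
    (f := fun _ => (1:ℝ)) (f' := fun _ => 0) (g := f) (g' := f')
    (v := EuclideanSpace.single i 1) (B := ContinuousLinearMap.mul ℝ ℝ)
    (by simp) (by simpa using hi) (by simpa using hc.integrable_of_hasCompactSupport hs)
    (fun x _ => hasDerivAt_const _ _) (fun x _ => hd x)
  simpa using this

lemma pd_symm (hf : ContDiff ℝ 2 f) (i j : Fin N) : pd i (pd j f) x = pd j (pd i f) x := by
  have h := (hf.contDiffAt (x := x)).isSymmSndFDerivAt (by simp)
  have hd : DifferentiableAt ℝ (fderiv ℝ f) x :=
    ((hf.fderiv_right (m := 1) (by norm_num)).differentiable (by norm_num)) x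
  have key : ∀ i j : Fin N, pd i (pd j f) x =
      fderiv ℝ (fderiv ℝ f) x (EuclideanSpace.single i 1) (EuclideanSpace.single j 1) := by
    intro i j
    unfold pd
    rw [fderiv_clm_apply hd (differentiableAt_const _)]
    simp
  rw [key, key]
  exact h _ _

lemma norm_gradient_sq (f : EuclideanSpace ℝ (Fin N) → ℝ) (x : EuclideanSpace ℝ (Fin N)) :
    ‖gradient f x‖ ^ 2 = ∑ i, (pd i f x) ^ 2 := by
  rw [← (EuclideanSpace.basisFun (Fin N) ℝ).sum_sq_norm_inner_left (gradient f x)]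
  refine Finset.sum_congr rfl fun i _ => ?_
  rw [gradient, EuclideanSpace.basisFun_apply, InnerProductSpace.toDual_symm_apply]
  simp [pd]

lemma sum_pd_sq_le (f : EuclideanSpace ℝ (Fin N) → ℝ) (x : EuclideanSpace ℝ (Fin N)) {C : ℝ}
    (h : ‖fderiv ℝ f x‖ ≤ C) :
    ∑ i, (pd i f x) ^ 2 ≤ C ^ 2 := by
  rw [← norm_gradient_sq]
  have : ‖gradient f x‖ = ‖fderiv ℝ f x‖ := by simp [gradient]
  rw [this]
  gcongr

lemma pd_zero_of_fderiv (h : fderiv ℝ f x = 0) : pd i f x = 0 := by simp [pd, h]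

lemma HasPD.normpow {a : ℝ} (ha : 0 ≤ a) :
    HasPD i (fun y => ‖y‖ ^ a * y i) (‖x‖ ^ a + a * ‖x‖ ^ (a - 2) * (x i) ^ 2) x := by
  by_cases hx : x = 0
  · subst hx
    have hi := HasPD.coord (x := (0 : EuclideanSpace ℝ (Fin N))) (i := i) i
    rcases ha.eq_or_lt with rfl | ha
    · simpa using hi
    · simp only [norm_zero, PiLp.zero_apply, Real.zero_rpow ha.ne']
      unfold HasPD HasLineDerivAt
      have : (fun t : ℝ => ‖(0 : EuclideanSpace ℝ (Fin N)) + t • EuclideanSpace.single i 1‖ ^ a *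
          ((0 : EuclideanSpace ℝ (Fin N)) + t • EuclideanSpace.single i 1).ofLp i)
          = fun t : ℝ => |t| ^ a * t := by
        ext t; simp [norm_smul]
      rw [this]
      have h2 := (hasDerivAt_iff_tendsto_slope_zero (f := fun t : ℝ => |t| ^ a * t) (f' := 0) (x := 0)).2 ?_
      · simpa using h2
      · have hc : Filter.Tendsto (fun t : ℝ => |t| ^ a) (nhdsWithin 0 {0}ᶜ) (nhds 0) := by
          have : Continuous (fun t : ℝ => |t| ^ a) := continuous_abs.rpow_const (fun _ => Or.inr ha.le)
          have h3 := this.tendsto 0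
          simp [Real.zero_rpow ha.ne'] at h3
          exact h3.mono_left nhdsWithin_le_nhds
        refine hc.congr' ?_
        filter_upwards [self_mem_nhdsWithin] with t ht
        have ht : t ≠ 0 := ht
        simp
        field_simp
  · have hn : 0 < ‖x‖ := norm_pos_iff.2 hx
    have h1 : HasFDerivAt (fun y : EuclideanSpace ℝ (Fin N) => (‖y‖ ^ 2) ^ (a / 2))
        (((a / 2) * (‖x‖ ^ 2) ^ (a / 2 - 1)) • (2 • (innerSL ℝ x))) x :=
      (hasStrictFDerivAt_norm_sq x).hasFDerivAt.rpow_const (Or.inl (by positivity))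
    have h2 : HasPD i (fun y => ‖y‖ ^ a) (a * ‖x‖ ^ (a - 2) * x i) x := by
      have h3 := h1.hasLineDerivAt (EuclideanSpace.single i 1)
      have e1 : (fun y : EuclideanSpace ℝ (Fin N) => (‖y‖ ^ 2) ^ (a / 2)) = fun y => ‖y‖ ^ a := by
        ext y
        rw [← Real.rpow_natCast, ← Real.rpow_mul (norm_nonneg _)]
        congr 1; push_cast; ring
      have e2 : (‖x‖ ^ 2) ^ (a / 2 - 1) = ‖x‖ ^ (a - 2) := by
        rw [← Real.rpow_natCast, ← Real.rpow_mul (norm_nonneg _)]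
        congr 1; push_cast; ring
      rw [e1, e2] at h3
      have e3 : ((a / 2 * ‖x‖ ^ (a - 2)) • 2 • (innerSL ℝ) x) (EuclideanSpace.single i 1)
          = a * ‖x‖ ^ (a - 2) * x i := by
        simp [EuclideanSpace.inner_single_right]
        ring
      rw [e3] at h3
      exact h3
    have h4 := h2.mul (HasPD.coord (x := x) (i := i) i)
    convert h4 using 1
    simp
    ring

end helpers

/-- `ψ` is a cutoff function between the balls of radius `R` and `2 * R`. -/
structure IsCut {N : ℕ} (C R : ℝ) (ψ : EuclideanSpace ℝ (Fin N) → ℝ) : Prop where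
  smooth : ContDiff ℝ 2 ψ
  comp : HasCompactSupport ψ
  nonneg : ∀ x, 0 ≤ ψ x
  le_one : ∀ x, ψ x ≤ 1
  one : ∀ x, ‖x‖ ≤ R → ψ x = 1
  zero : ∀ x, 2 * R ≤ ‖x‖ → ψ x = 0
  bound : ∀ x, ‖fderiv ℝ ψ x‖ ≤ C / R
  d_in : ∀ x, ‖x‖ < R → fderiv ℝ ψ x = 0
  d_out : ∀ x, 2 * R < ‖x‖ → fderiv ℝ ψ x = 0

lemma exists_cutoff (N : ℕ) : ∃ C : ℝ, 0 < C ∧ ∀ R : ℝ, 0 < R →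
    ∃ ψ : EuclideanSpace ℝ (Fin N) → ℝ, IsCut C R ψ := by
  let b : ContDiffBump (0 : EuclideanSpace ℝ (Fin N)) := ⟨1, 2, by norm_num, by norm_num⟩
  have hbs : ContDiff ℝ 2 b := b.contDiff
  have hcs : HasCompactSupport (fderiv ℝ b) := b.hasCompactSupport.fderiv ℝ
  obtain ⟨C, hC⟩ := (hbs.continuous_fderiv (by norm_num)).bounded_above_of_compact_support hcs
  refine ⟨max C 1, by positivity, fun R hR => ⟨fun x => b (R⁻¹ • x), ?_⟩⟩
  have hn : ∀ x : EuclideanSpace ℝ (Fin N), ‖R⁻¹ • x‖ = ‖x‖ / R := fun x => by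
    rw [norm_smul, norm_inv, Real.norm_of_nonneg hR.le]; ring
  have hone : ∀ x : EuclideanSpace ℝ (Fin N), ‖x‖ ≤ R → b (R⁻¹ • x) = 1 := fun x hx => by
    apply b.one_of_mem_closedBall
    rw [mem_closedBall_zero_iff, hn, div_le_iff₀ hR]
    simpa [b] using hx
  have hzero : ∀ x : EuclideanSpace ℝ (Fin N), 2 * R ≤ ‖x‖ → b (R⁻¹ • x) = 0 := fun x hx => by
    apply b.zero_of_le_dist
    rw [dist_zero_right, hn, le_div_iff₀ hR]
    simpa [b] using hx
  refine ⟨hbs.comp (contDiff_const_smul _), ?_, fun x => b.nonneg, fun x => b.le_one, hone, hzero,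
    ?_, ?_, ?_⟩
  · refine HasCompactSupport.of_support_subset_isCompact (isCompact_closedBall 0 (2 * R)) ?_
    intro x hx
    by_contra h
    rw [mem_closedBall_zero_iff, not_le] at h
    exact hx (hzero x h.le)
  · intro x
    have h1 : HasFDerivAt (fun x => b (R⁻¹ • x)) ((fderiv ℝ b (R⁻¹ • x)).comp
        (R⁻¹ • ContinuousLinearMap.id ℝ (EuclideanSpace ℝ (Fin N)))) x := by
      have h2 : HasFDerivAt (fun x : EuclideanSpace ℝ (Fin N) => R⁻¹ • x)
        (R⁻¹ • ContinuousLinearMap.id ℝ (EuclideanSpace ℝ (Fin N))) x :=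
        (hasFDerivAt_id x).fun_const_smul R⁻¹
      exact HasFDerivAt.comp (g := (b : EuclideanSpace ℝ (Fin N) → ℝ)) x ((hbs.differentiable (by norm_num)) _).hasFDerivAt h2
    rw [h1.fderiv]
    have h3 : (fderiv ℝ b (R⁻¹ • x)).comp
        (R⁻¹ • ContinuousLinearMap.id ℝ (EuclideanSpace ℝ (Fin N))) = R⁻¹ • fderiv ℝ b (R⁻¹ • x) := by
      ext y; simp
    rw [h3, norm_smul, norm_inv, Real.norm_of_nonneg hR.le, div_eq_inv_mul]
    gcongr
    exact (hC _).trans (le_max_left _ _)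
  · intro x hx
    have : (fun x => b (R⁻¹ • x)) =ᶠ[nhds x] fun _ => 1 := by
      filter_upwards [(isOpen_lt continuous_norm continuous_const).mem_nhds hx] with y hy
      exact hone y (le_of_lt hy)
    rw [this.fderiv_eq]; simp
  · intro x hx
    have : (fun x => b (R⁻¹ • x)) =ᶠ[nhds x] fun _ => 0 := by
      filter_upwards [(isOpen_lt continuous_const continuous_norm).mem_nhds hx] with y hy
      exact hzero y (le_of_lt hy)
    rw [this.fderiv_eq]; simp

lemma pointwise_young {a p A : ℝ} (ha : 0 ≤ a) (hp : 1 < p) (hA : 0 < A) {k : ℕ}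
    (hk : 2 ≤ k * (p - 1)) {R v s r : ℝ} (hR : 0 < R) (hv : 0 < v) (hs : 0 ≤ s) (hs1 : s ≤ 1)
    (hr : R ≤ r) :
    A * R⁻¹ ^ 2 * v ^ 2 * s ^ (2 * k) ≤ r ^ a * v ^ (p + 1) * s ^ (2 * (k + 1)) +
      A * A ^ (2 / (p - 1)) * R ^ (-(2 * (p + 1 + a) / (p - 1))) := by
  have hp1 : 0 < p - 1 := by linarith
  have hRa : R ^ a ≤ r ^ a := Real.rpow_le_rpow hR.le hr ha
  have hR0 : 0 < R ^ a := by positivity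
  have hvp : v ^ (p + 1) = v ^ (p - 1) * v ^ 2 := by
    rw [← Real.rpow_natCast v 2, ← Real.rpow_add hv]; congr 1; push_cast; ring
  by_cases hc : A * R⁻¹ ^ 2 ≤ R ^ a * v ^ (p - 1) * s ^ 2
  · have h1 : A * R⁻¹ ^ 2 * (v ^ 2 * s ^ (2 * k)) ≤ r ^ a * v ^ (p - 1) * s ^ 2 * (v ^ 2 * s ^ (2 * k)) := by
      apply mul_le_mul_of_nonneg_right _ (by positivity)
      refine hc.trans ?_
      gcongr
    have h2 : 0 ≤ A * A ^ (2 / (p - 1)) * R ^ (-(2 * (p + 1 + a) / (p - 1))) := by positivity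
    have h3 : r ^ a * v ^ (p + 1) * s ^ (2 * (k + 1)) =
        r ^ a * v ^ (p - 1) * s ^ 2 * (v ^ 2 * s ^ (2 * k)) := by
      rw [hvp]; ring
    rw [h3]; linarith
  · push Not at hc
    have h0 : 0 ≤ r ^ a * v ^ (p + 1) * s ^ (2 * (k + 1)) := by
      have : 0 ≤ r := hR.le.trans hr
      positivity
    have h1 : v ^ (p - 1) * s ^ 2 ≤ A * R ^ (-(2 + a)) := by
      have e : R ^ (-(2 + a)) = R⁻¹ ^ 2 * (R ^ a)⁻¹ := by
        rw [Real.rpow_neg hR.le, Real.rpow_add hR, mul_inv]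
        congr 1
        rw [inv_pow]; norm_cast
      rw [e, ← mul_assoc, ← div_eq_mul_inv, le_div_iff₀ hR0]
      linarith
    have h2 : (v ^ (p - 1) * s ^ 2) ^ (2 / (p - 1)) ≤ (A * R ^ (-(2 + a))) ^ (2 / (p - 1)) :=
      Real.rpow_le_rpow (by positivity) h1 (by positivity)
    have h3 : (v ^ (p - 1) * s ^ 2) ^ (2 / (p - 1)) = v ^ 2 * s ^ (4 / (p - 1)) := by
      rw [Real.mul_rpow (by positivity) (by positivity), ← Real.rpow_mul hv.le,
        ← Real.rpow_natCast s 2, ← Real.rpow_mul hs, ← Real.rpow_natCast v 2]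
      congr 2
      · push_cast; field_simp
      · push_cast; ring
    have h4 : (A * R ^ (-(2 + a))) ^ (2 / (p - 1)) = A ^ (2 / (p - 1)) * R ^ (-(2 + a) * (2 / (p - 1))) := by
      rw [Real.mul_rpow (by positivity) (by positivity), ← Real.rpow_mul hR.le]
    have h5 : s ^ (2 * k) ≤ s ^ (4 / (p - 1)) := by
      rw [← Real.rpow_natCast s (2 * k)]
      refine Real.rpow_le_rpow_of_exponent_ge_of_imp hs hs1 ?_ ?_
      · rw [div_le_iff₀ hp1]; push_cast; linarith
      · intro _ h
        exfalso
        have hk0 : (k : ℝ) = 0 := by push_cast at h; linarith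
        rw [hk0] at hk
        linarith
    have h6 : R ^ (-(2 * (p + 1 + a) / (p - 1))) = R⁻¹ ^ 2 * R ^ (-(2 + a) * (2 / (p - 1))) := by
      have : R⁻¹ ^ 2 = R ^ (-2 : ℝ) := by
        rw [Real.rpow_neg hR.le, inv_pow]; norm_cast
      rw [this, ← Real.rpow_add hR]
      congr 1
      field_simp
      ring
    have h7 : v ^ 2 * s ^ (2 * k) ≤ A ^ (2 / (p - 1)) * R ^ (-(2 + a) * (2 / (p - 1))) := by
      rw [← h4]
      calc v ^ 2 * s ^ (2 * k) ≤ v ^ 2 * s ^ (4 / (p - 1)) := by gcongr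
        _ ≤ _ := by rw [← h3]; exact h2
    have h8 : A * R⁻¹ ^ 2 * (v ^ 2 * s ^ (2 * k)) ≤
      A * R⁻¹ ^ 2 * (A ^ (2 / (p - 1)) * R ^ (-(2 + a) * (2 / (p - 1)))) :=
        mul_le_mul_of_nonneg_left h7 (by positivity)
    rw [h6]
    linarith

lemma vol_decay {N : ℕ} {θ : ℝ} (hθ : (N : ℝ) < θ) :
    Filter.Tendsto (fun n : ℕ => ((n : ℝ) + 1) ^ (-θ) *
      (volume : Measure (EuclideanSpace ℝ (Fin N))).real (Metric.closedBall 0 (2 * ((n : ℝ) + 1))))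
      Filter.atTop (nhds 0) := by
  have h1 : ∀ n : ℕ, ((n : ℝ) + 1) ^ (-θ) *
      (volume : Measure (EuclideanSpace ℝ (Fin N))).real (Metric.closedBall 0 (2 * ((n : ℝ) + 1)))
      = ((n : ℝ) + 1) ^ (-(θ - N)) * (2 ^ N *
        (volume : Measure (EuclideanSpace ℝ (Fin N))).real (Metric.closedBall 0 1)) := by
    intro n
    have hn : (0:ℝ) < n + 1 := by positivity
    rw [MeasureTheory.Measure.addHaar_real_closedBall' _ _ (by positivity), finrank_euclideanSpace_fin,
      mul_pow, ← Real.rpow_natCast ((n : ℝ) + 1) N]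
    have : ((n : ℝ) + 1) ^ (-(θ - N)) = ((n : ℝ) + 1) ^ (-θ) * ((n : ℝ) + 1) ^ (N : ℝ) := by
      rw [← Real.rpow_add hn]; congr 1; ring
    rw [this]; ring
  simp_rw [h1]
  have h2 : Filter.Tendsto (fun n : ℕ => ((n : ℝ) + 1) ^ (-(θ - N))) Filter.atTop (nhds 0) :=
    (tendsto_rpow_neg_atTop (by linarith)).comp
      (Filter.tendsto_atTop_add_const_right _ _ tendsto_natCast_atTop_atTop)
  simpa using h2.mul_const _

section sol
variable {N : ℕ}

lemma int_mul {F ζ : EuclideanSpace ℝ (Fin N) → ℝ} (hF : Continuous F) (hζ : Continuous ζ)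
    (hs : HasCompactSupport ζ) : Integrable (fun x => F x * ζ x) :=
  (hF.mul hζ).integrable_of_hasCompactSupport hs.mul_left

lemma compact_pd {ζ : EuclideanSpace ℝ (Fin N) → ℝ} (i : Fin N)
    (hs : HasCompactSupport ζ) : HasCompactSupport (pd i ζ) :=
  hs.fderiv_apply ℝ _

variable {a p : ℝ} {u : EuclideanSpace ℝ (Fin N) → ℝ}

/-- The squared gradient. -/
noncomputable def gsq (u : EuclideanSpace ℝ (Fin N) → ℝ) (x : EuclideanSpace ℝ (Fin N)) : ℝ :=
  ∑ i, pd i u x ^ 2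

/-- The potential density. -/
noncomputable def dens (a p : ℝ) (u : EuclideanSpace ℝ (Fin N) → ℝ)
    (x : EuclideanSpace ℝ (Fin N)) : ℝ := ‖x‖ ^ a * u x ^ (p + 1)

lemma gsq_nonneg (x : EuclideanSpace ℝ (Fin N)) : 0 ≤ gsq u x :=
  Finset.sum_nonneg fun _ _ => sq_nonneg _

lemma dens_nonneg (hpos : ∀ x, 0 < u x) (x : EuclideanSpace ℝ (Fin N)) : 0 ≤ dens a p u x := by
  have := hpos x
  unfold dens; positivity

lemma gsq_cont (hu : ContDiff ℝ 1 u) : Continuous (gsq u) :=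
  continuous_finsetSum _ fun _ _ => (continuous_pd hu).pow 2

lemma dens_cont (ha : 0 ≤ a) (hu : ContDiff ℝ 1 u) (hpos : ∀ x, 0 < u x) :
    Continuous (dens a p u) :=
  (continuous_norm.rpow_const fun _ => Or.inr ha).mul
    (hu.continuous.rpow_const fun x => Or.inl (hpos x).ne')

lemma cs_pd (f h : EuclideanSpace ℝ (Fin N) → ℝ) (x : EuclideanSpace ℝ (Fin N)) :
    (∑ i, pd i f x * pd i h x) ^ 2 ≤ gsq f x * gsq h x :=
  Finset.sum_mul_sq_le_sq_mul_sq _ _ _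

lemma lap_eq (u : EuclideanSpace ℝ (Fin N) → ℝ) (x : EuclideanSpace ℝ (Fin N)) :
    lap u x = ∑ i, pd i (pd i u) x := rfl

lemma energy (hu : ContDiff ℝ 2 u) (hpos : ∀ x, 0 < u x)
    (heq : ∀ x, -lap u x = ‖x‖ ^ a * u x ^ p) {ζ : EuclideanSpace ℝ (Fin N) → ℝ}
    (hζ : ContDiff ℝ 1 ζ) (hs : HasCompactSupport ζ) :
    Integrable (fun x => gsq u x * ζ x - dens a p u x * ζ x + u x * ∑ i, pd i u x * pd i ζ x) ∧
    ∫ x, (gsq u x * ζ x - dens a p u x * ζ x + u x * ∑ i, pd i u x * pd i ζ x) = 0 := by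
  have hu1 : ContDiff ℝ 1 u := hu.of_le (by norm_num)
  have hui : ∀ i, ContDiff ℝ 1 (pd i u) := fun i => contDiff_pd hu
  have hd : ∀ x, DifferentiableAt ℝ u x := fun x => (hu1.differentiable (by norm_num)) x
  have hdi : ∀ i x, DifferentiableAt ℝ (pd i u) x := fun i x =>
    ((hui i).differentiable (by norm_num)) x
  have hdζ : ∀ x, DifferentiableAt ℝ ζ x := fun x => (hζ.differentiable (by norm_num)) x
  let d : Fin N → EuclideanSpace ℝ (Fin N) → ℝ := fun i x =>
    (pd i (pd i u) x * u x + pd i u x * pd i u x) * ζ x + (pd i u x * u x) * pd i ζ x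
  have hdInt : ∀ i, Integrable (d i) := fun i =>
    (int_mul (((continuous_pd (hui i)).mul hu1.continuous).add
      ((continuous_pd hu1).mul (continuous_pd hu1))) hζ.continuous hs).add
    (int_mul ((continuous_pd hu1).mul hu1.continuous) (continuous_pd hζ) (compact_pd i hs))
  have hz : ∀ i, ∫ x, d i x = 0 := fun i => by
    refine integral_pd_zero (i := i) (f := fun x => (pd i u x * u x) * ζ x) ?_ hs.mul_left ?_ (hdInt i)
    · exact ((continuous_pd hu1).mul hu1.continuous).mul hζ.continuous
    · intro x
      exact ((HasPD.of_diff (hdi i x)).mul (HasPD.of_diff (hd x))).mul (HasPD.of_diff (hdζ x))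
  have hsum : ∫ x, ∑ i, d i x = 0 := by
    rw [integral_finsetSum _ (fun i _ => hdInt i)]
    exact Finset.sum_eq_zero fun i _ => hz i
  suffices hfun : (fun x => gsq u x * ζ x - dens a p u x * ζ x + u x * ∑ i, pd i u x * pd i ζ x)
      = fun x => ∑ i, d i x by
    rw [hfun]
    exact ⟨integrable_finsetSum _ fun i _ => hdInt i, hsum⟩
  ext x
  have h1 : dens a p u x = -(∑ i, pd i (pd i u) x) * u x := by
    rw [← lap_eq, heq, dens, Real.rpow_add_one (hpos x).ne']; ring
  rw [h1]
  simp only [d, gsq, Finset.sum_add_distrib, ← Finset.sum_mul, add_mul]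
  simp only [Finset.mul_sum, sq]
  have : ∀ i, u x * (pd i u x * pd i ζ x) = pd i u x * u x * pd i ζ x := fun i => by ring
  simp only [this]
  ring

lemma stable_ineq (hu : ContDiff ℝ 2 u) (ha : 0 ≤ a) (hpos : ∀ x, 0 < u x)
    (heq : ∀ x, -lap u x = ‖x‖ ^ a * u x ^ p) {K : Set (EuclideanSpace ℝ (Fin N))}
    (hst : ∀ φ : EuclideanSpace ℝ (Fin N) → ℝ,
            ContDiff ℝ 1 φ → HasCompactSupport φ → Disjoint (tsupport φ) K →
            0 ≤ (∫ x, ‖gradient φ x‖ ^ 2) - p * ∫ x, ‖x‖ ^ a * u x ^ (p - 1) * φ x ^ 2)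
    {η : EuclideanSpace ℝ (Fin N) → ℝ}
    (hη : ContDiff ℝ 1 η) (hs : HasCompactSupport η) (hK : Disjoint (tsupport η) K) :
    (p - 1) * ∫ x, dens a p u x * η x ^ 2 ≤ ∫ x, u x ^ 2 * gsq η x := by
  have hu1 : ContDiff ℝ 1 u := hu.of_le (by norm_num)
  have hd : ∀ x, DifferentiableAt ℝ u x := fun x => (hu1.differentiable (by norm_num)) x
  have hdη : ∀ x, DifferentiableAt ℝ η x := fun x => (hη.differentiable (by norm_num)) x
  have h1 := hst (fun x => u x * η x) (hu1.mul hη) hs.mul_left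
    (hK.mono_left (tsupport_mul_subset_right))
  have hs2 : HasCompactSupport (fun x => η x ^ 2) := by
    have := hs.mul_left (f := η)
    have e : (fun x => η x ^ 2) = η * η := by ext x; simp [sq]
    rw [e]; exact this
  obtain ⟨i3, h2⟩ := energy hu hpos heq (hη.pow 2) hs2
  have e1 : ∀ x, ‖x‖ ^ a * u x ^ (p - 1) * (u x * η x) ^ 2 = dens a p u x * η x ^ 2 := fun x => by
    have : u x ^ (p + 1) = u x ^ (p - 1) * u x ^ 2 := by
      rw [← Real.rpow_natCast (u x) 2, ← Real.rpow_add (hpos x)]; congr 1; push_cast; ring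
    rw [dens, this]; ring
  have i1 : Integrable (fun x => dens a p u x * η x ^ 2) :=
    int_mul (dens_cont ha hu1 hpos) (hη.continuous.pow 2) hs2
  have i2 : Integrable (fun x => u x ^ 2 * gsq η x) := by
    refine int_mul (hu1.continuous.pow 2) (gsq_cont hη) ?_
    refine (hs.fderiv ℝ).mono ?_
    intro x hx h0
    apply hx
    refine Finset.sum_eq_zero fun i _ => ?_
    rw [pd_zero_of_fderiv h0]; simp
  have e2 : ∀ x, ‖gradient (fun x => u x * η x) x‖ ^ 2 =
      (gsq u x * η x ^ 2 - dens a p u x * η x ^ 2 + u x * ∑ i, pd i u x * pd i (fun x => η x ^ 2) x)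
      + (dens a p u x * η x ^ 2 + u x ^ 2 * gsq η x) := fun x => by
    rw [norm_gradient_sq]
    have q1 : ∀ i, pd i (fun x => u x * η x) x = pd i u x * η x + u x * pd i η x := fun i =>
      ((HasPD.of_diff (hd x)).mul (HasPD.of_diff (hdη x))).pd_eq ((hd x).mul (hdη x))
    have q2 : ∀ i, pd i (fun x => η x ^ 2) x = pd i η x * η x + η x * pd i η x := fun i => by
      have := ((HasPD.of_diff (i := i) (hdη x)).mul (HasPD.of_diff (hdη x)))
      refine HasPD.pd_eq ((hdη x).pow 2) ?_
      simpa [sq] using this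
    simp only [q1, q2, gsq]
    simp only [Finset.mul_sum, Finset.sum_mul]
    rw [show ∀ A B C D : ℝ, A - B + C + (B + D) = A + C + D by intros; ring,
      ← Finset.sum_add_distrib, ← Finset.sum_add_distrib]
    refine Finset.sum_congr rfl fun i _ => ?_
    ring
  simp only [e1, e2] at h1
  have i12 : Integrable (fun x => dens a p u x * η x ^ 2 + u x ^ 2 * gsq η x) := i1.add i2
  rw [integral_add i3 i12, h2, integral_add i1 i2] at h1
  linarith

lemma pohozaev (hu : ContDiff ℝ 2 u) (ha : 0 ≤ a) (hp : 1 < p) (hpos : ∀ x, 0 < u x)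
    (heq : ∀ x, -lap u x = ‖x‖ ^ a * u x ^ p) {ψ : EuclideanSpace ℝ (Fin N) → ℝ}
    (hψ : ContDiff ℝ 1 ψ) (hs : HasCompactSupport ψ) :
    Integrable (fun x : EuclideanSpace ℝ (Fin N) => ((1 - N / 2) * gsq u x + (N + a) / (p + 1) * dens a p u x) * ψ x +
      ((∑ j, x j * pd j u x) * (∑ i, pd i u x * pd i ψ x) +
        (1 / (p + 1) * dens a p u x - 1 / 2 * gsq u x) * ∑ i, x i * pd i ψ x)) ∧
    ∫ x, (((1 - N / 2) * gsq u x + (N + a) / (p + 1) * dens a p u x) * ψ x +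
      ((∑ j, x j * pd j u x) * (∑ i, pd i u x * pd i ψ x) +
        (1 / (p + 1) * dens a p u x - 1 / 2 * gsq u x) * ∑ i, x i * pd i ψ x)) = 0 := by
  have hu1 : ContDiff ℝ 1 u := hu.of_le (by norm_num)
  have hui : ∀ i, ContDiff ℝ 1 (pd i u) := fun i => contDiff_pd hu
  have hd : ∀ x, DifferentiableAt ℝ u x := fun x => (hu1.differentiable (by norm_num)) x
  have hdi : ∀ i x, DifferentiableAt ℝ (pd i u) x := fun i x =>
    ((hui i).differentiable (by norm_num)) x
  have hdψ : ∀ x, DifferentiableAt ℝ ψ x := fun x => (hψ.differentiable (by norm_num)) x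
  have hp1 : 0 < p + 1 := by linarith
  have hcu : ∀ i, Continuous (pd i u) := fun i => continuous_pd hu1
  have hcuu : ∀ i j, Continuous (pd i (pd j u)) := fun i j => continuous_pd (hui j)
  have hcx : ∀ i : Fin N, Continuous (fun x : EuclideanSpace ℝ (Fin N) => x i) := fun i => by fun_prop
  have hcn : Continuous (fun x : EuclideanSpace ℝ (Fin N) => ‖x‖ ^ a) :=
    continuous_norm.rpow_const fun _ => Or.inr ha
  have hcv : ∀ q : ℝ, Continuous (fun x => u x ^ q) := fun q =>
    hu1.continuous.rpow_const fun x => Or.inl (hpos x).ne'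
  have hcψ := hψ.continuous
  have hcψi : ∀ i, Continuous (pd i ψ) := fun i => continuous_pd hψ
  have hcg : Continuous (gsq u) := gsq_cont hu1
  have hcS : Continuous (fun x : EuclideanSpace ℝ (Fin N) => ∑ j, x j * pd j u x) :=
    continuous_finsetSum _ fun j _ => (hcx j).mul (hcu j)
  have hPV : ∀ i x, HasPD i (fun x => u x ^ (p + 1)) ((p + 1) * u x ^ p * pd i u x) x := by
    intro i x
    have h1 : HasDerivAt (fun t : ℝ => u (x + t • EuclideanSpace.single i 1)) (pd i u x) 0 :=
      HasPD.of_diff (hd x)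
    have h2 := h1.rpow_const (p := p + 1) (Or.inl (hpos _).ne')
    have e : pd i u x * (p + 1) * u (x + (0:ℝ) • EuclideanSpace.single i 1) ^ (p + 1 - 1)
      = (p + 1) * u x ^ p * pd i u x := by
      rw [zero_smul, add_zero, add_sub_cancel_right]; ring
    rw [e] at h2
    exact h2
  let d1 : Fin N → EuclideanSpace ℝ (Fin N) → ℝ := fun i x =>
    ((pd i u x + ∑ j, x j * pd i (pd j u) x) * pd i u x
        + (∑ j, x j * pd j u x) * pd i (pd i u) x
      - ((1 / 2) * (∑ j, (pd i (pd j u) x * pd j u x + pd j u x * pd i (pd j u) x)) * x i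
        + (1 / 2) * gsq u x)) * ψ x
    + ((∑ j, x j * pd j u x) * pd i u x - (1 / 2) * gsq u x * x i) * pd i ψ x
  let d2 : Fin N → EuclideanSpace ℝ (Fin N) → ℝ := fun i x =>
    (((p + 1) * u x ^ p * pd i u x) * ψ x + u x ^ (p + 1) * pd i ψ x) * (‖x‖ ^ a * x i)
    + (u x ^ (p + 1) * ψ x) * (‖x‖ ^ a + a * ‖x‖ ^ (a - 2) * (x i) ^ 2)
  have hdInt1 : ∀ i, Integrable (d1 i) := fun i => by
    refine Integrable.add ?_ ?_
    · refine int_mul ?_ hcψ hs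
      have := hcu i
      have := hcuu i i
      have := hcx i
      have c1 : Continuous (fun x : EuclideanSpace ℝ (Fin N) => ∑ j, x j * pd i (pd j u) x) :=
        continuous_finsetSum _ fun j _ => (hcx j).mul (hcuu i j)
      have c2 : Continuous (fun x : EuclideanSpace ℝ (Fin N) =>
          ∑ j, (pd i (pd j u) x * pd j u x + pd j u x * pd i (pd j u) x)) :=
        continuous_finsetSum _ fun j _ => ((hcuu i j).mul (hcu j)).add ((hcu j).mul (hcuu i j))
      fun_prop
    · refine int_mul ?_ (hcψi i) (compact_pd i hs)
      have := hcu i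
      have := hcx i
      fun_prop
  have hdInt2 : ∀ i, Integrable (d2 i) := fun i => by
    have k1 : Integrable (fun x => (u x ^ (p + 1) * ‖x‖ ^ a) * ψ x) :=
      int_mul ((hcv _).mul hcn) hcψ hs
    have k2 : Integrable (fun x => (((p + 1) * u x ^ p * pd i u x) * (‖x‖ ^ a * x i)) * ψ x) := by
      refine int_mul ?_ hcψ hs
      have := hcu i
      have := hcx i
      have := hcv p
      fun_prop
    have k3 : Integrable (fun x => (u x ^ (p + 1) * (‖x‖ ^ a * x i)) * pd i ψ x) := by
      refine int_mul ?_ (hcψi i) (compact_pd i hs)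
      have := hcx i
      have := hcv (p + 1)
      fun_prop
    have k4 : Integrable (fun x => (u x ^ (p + 1) * ψ x) * (a * ‖x‖ ^ (a - 2) * (x i) ^ 2)) := by
      refine Integrable.mono' (k1.norm.const_mul a) ?_ ?_
      · have m1 : Measurable (fun x => u x ^ (p + 1) * ψ x) := ((hcv _).mul hcψ).measurable
        have m2 : Measurable (fun x : EuclideanSpace ℝ (Fin N) => (x i) ^ 2) :=
          ((hcx i).pow 2).measurable
        have m3 : Measurable (fun x : EuclideanSpace ℝ (Fin N) => a * ‖x‖ ^ (a - 2)) :=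
          (measurable_norm.pow_const _).const_mul _
        exact (m1.mul (m3.mul m2)).aestronglyMeasurable
      · refine Filter.Eventually.of_forall fun x => ?_
        have hx : ‖x‖ ^ (a - 2) * (x i) ^ 2 ≤ ‖x‖ ^ a := by
          rcases eq_or_ne x 0 with rfl | hx0
          · simp; positivity
          · have hn : 0 < ‖x‖ := norm_pos_iff.2 hx0
            have e : ‖x‖ ^ a = ‖x‖ ^ (a - 2) * ‖x‖ ^ 2 := by
              rw [← Real.rpow_natCast ‖x‖ 2, ← Real.rpow_add hn]; congr 1; push_cast; ring
            rw [e]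
            gcongr ?_ * ?_
            have := PiLp.norm_apply_le x i
            rw [← sq_abs]
            gcongr
            simpa using this
        have hup : 0 ≤ u x ^ (p + 1) := (Real.rpow_pos_of_pos (hpos x) _).le
        simp only [Real.norm_eq_abs, abs_mul]
        rw [abs_of_nonneg hup, abs_of_nonneg (show 0 ≤ ‖x‖ ^ a by positivity), abs_of_nonneg ha,
          abs_of_nonneg (show 0 ≤ ‖x‖ ^ (a - 2) by positivity), abs_of_nonneg (sq_nonneg (x i))]
        calc _ = a * (u x ^ (p + 1) * |ψ x|) * (‖x‖ ^ (a - 2) * (x i) ^ 2) := by ring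
          _ ≤ a * (u x ^ (p + 1) * |ψ x|) * ‖x‖ ^ a := by gcongr
          _ = _ := by ring
    refine (((k1.add k2).add k3).add k4).congr (Filter.Eventually.of_forall fun x => ?_)
    simp only [d2, Pi.add_apply]
    ring
  have hz1 : ∀ i, ∫ x, d1 i x = 0 := fun i => by
    refine integral_pd_zero (i := i) (f := fun x => ((∑ j, x j * pd j u x) * pd i u x
      - (1 / 2) * gsq u x * x i) * ψ x) ?_ hs.mul_left ?_ (hdInt1 i)
    · have := hcu i
      have := hcx i
      fun_prop
    · intro x
      have s1 : HasPD i (fun x => ∑ j, x j * pd j u x) (pd i u x + ∑ j, x j * pd i (pd j u) x) x := by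
        have := HasPD.sum (i := i) (x := x) fun j =>
          (HasPD.coord (i := i) (x := x) j).mul (HasPD.of_diff (i := i) (hdi j x))
        have e : ∑ j, ((if j = i then 1 else 0) * pd j u x + x j * pd i (pd j u) x)
            = pd i u x + ∑ j, x j * pd i (pd j u) x := by
          rw [Finset.sum_add_distrib]; simp
        rw [e] at this
        exact this
      have s2 : HasPD i (gsq u)
          (∑ j, (pd i (pd j u) x * pd j u x + pd j u x * pd i (pd j u) x)) x := by
        have := HasPD.sum (i := i) (x := x) fun j =>
          (HasPD.of_diff (i := i) (hdi j x)).mul (HasPD.of_diff (i := i) (hdi j x))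
        have e : gsq u = fun x => ∑ j, pd j u x * pd j u x := by ext y; simp [gsq, sq]
        rw [e]
        exact this
      have s3 := ((s1.mul (HasPD.of_diff (i := i) (hdi i x))).sub
        ((s2.const_mul (1 / 2)).mul (HasPD.coord (i := i) (x := x) i))).mul
        (HasPD.of_diff (i := i) (hdψ x))
      simp only [if_true, mul_one] at s3
      exact s3
  have hz2 : ∀ i, ∫ x, d2 i x = 0 := fun i => by
    refine integral_pd_zero (i := i) (f := fun x => (u x ^ (p + 1) * ψ x) * (‖x‖ ^ a * x i)) ?_
      hs.mul_left.mul_right ?_ (hdInt2 i)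
    · have := hcv (p + 1)
      have := hcx i
      fun_prop
    · intro x
      exact ((hPV i x).mul (HasPD.of_diff (hdψ x))).mul (HasPD.normpow ha)
  have hsum1 : ∫ x, ∑ i, d1 i x = 0 := by
    rw [integral_finsetSum _ (fun i _ => hdInt1 i)]
    exact Finset.sum_eq_zero fun i _ => hz1 i
  have hsum2 : ∫ x, (1 / (p + 1)) * ∑ i, d2 i x = 0 := by
    rw [integral_const_mul, integral_finsetSum _ (fun i _ => hdInt2 i)]
    rw [Finset.sum_eq_zero fun i _ => hz2 i, mul_zero]
  have hsum : ∫ x, (∑ i, d1 i x + (1 / (p + 1)) * ∑ i, d2 i x) = 0 := by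
    rw [integral_add (integrable_finsetSum _ fun i _ => hdInt1 i)
      ((integrable_finsetSum _ fun i _ => hdInt2 i).const_mul _), hsum1, hsum2, add_zero]
  suffices hfun : (fun x : EuclideanSpace ℝ (Fin N) => ((1 - N / 2) * gsq u x + (N + a) / (p + 1) * dens a p u x) * ψ x +
      ((∑ j, x j * pd j u x) * (∑ i, pd i u x * pd i ψ x) +
        (1 / (p + 1) * dens a p u x - 1 / 2 * gsq u x) * ∑ i, x i * pd i ψ x))
      = fun x => ∑ i, d1 i x + (1 / (p + 1)) * ∑ i, d2 i x by
    rw [hfun]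
    exact ⟨(integrable_finsetSum _ fun i _ => hdInt1 i).add
      ((integrable_finsetSum _ fun i _ => hdInt2 i).const_mul _), hsum⟩
  ext x
  have t1 : ∑ i, d1 i x = ((1 - N / 2) * gsq u x + (∑ j, x j * pd j u x) * lap u x) * ψ x
      + ((∑ j, x j * pd j u x) * (∑ i, pd i u x * pd i ψ x)
        - 1 / 2 * gsq u x * ∑ i, x i * pd i ψ x) := by
    have sw : ∑ i, (∑ j, x j * pd i (pd j u) x) * pd i u x
        = ∑ i, (1 / 2) * (∑ j, (pd i (pd j u) x * pd j u x + pd j u x * pd i (pd j u) x)) * x i := by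
      simp only [Finset.mul_sum, Finset.sum_mul]
      rw [Finset.sum_comm]
      refine Finset.sum_congr rfl fun i _ => Finset.sum_congr rfl fun j _ => ?_
      rw [pd_symm hu j i]; ring
    have e1 : ∑ i, d1 i x = (∑ i, pd i u x ^ 2 + ∑ i, (∑ j, x j * pd i (pd j u) x) * pd i u x
        + (∑ j, x j * pd j u x) * (∑ i, pd i (pd i u) x)
        - ∑ i, (1 / 2) * (∑ j, (pd i (pd j u) x * pd j u x + pd j u x * pd i (pd j u) x)) * x i
        - ∑ i : Fin N, 1 / 2 * gsq u x) * ψ x +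
        ((∑ j, x j * pd j u x) * (∑ i, pd i u x * pd i ψ x)
        - 1 / 2 * gsq u x * ∑ i, x i * pd i ψ x) := by
      rw [Finset.mul_sum (s := Finset.univ) (f := fun i => pd i (pd i u) x),
        Finset.mul_sum (s := Finset.univ) (f := fun i => pd i u x * pd i ψ x),
        Finset.mul_sum (s := Finset.univ) (f := fun i => x i * pd i ψ x),
        ← Finset.sum_add_distrib, ← Finset.sum_add_distrib, ← Finset.sum_sub_distrib,
        ← Finset.sum_sub_distrib, ← Finset.sum_sub_distrib, Finset.sum_mul,
        ← Finset.sum_add_distrib]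
      refine Finset.sum_congr rfl fun i _ => ?_
      simp only [d1]
      ring
    rw [e1, sw, lap_eq]
    simp only [Finset.sum_const, Finset.card_univ, Fintype.card_fin, nsmul_eq_mul]
    rw [show ∑ i, pd i u x ^ 2 = gsq u x from rfl]
    ring
  have t2 : ∑ i, d2 i x = (p + 1) * u x ^ p * ‖x‖ ^ a * (∑ j, x j * pd j u x) * ψ x
      + dens a p u x * (∑ i, x i * pd i ψ x) + (N + a) * dens a p u x * ψ x := by
    have hxs : a * (‖x‖ ^ (a - 2) * ∑ i, x i ^ 2) = a * ‖x‖ ^ a := by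
      rcases eq_or_ne x 0 with rfl | hx0
      · rcases ha.eq_or_lt with rfl | ha
        · simp
        · simp [Real.zero_rpow ha.ne']
      · have hn : 0 < ‖x‖ := norm_pos_iff.2 hx0
        have e : ‖x‖ ^ a = ‖x‖ ^ (a - 2) * ‖x‖ ^ 2 := by
          rw [← Real.rpow_natCast ‖x‖ 2, ← Real.rpow_add hn]; congr 1; push_cast; ring
        rw [e, EuclideanSpace.real_norm_sq_eq]
    have e1 : ∑ i, d2 i x = (p + 1) * u x ^ p * ‖x‖ ^ a * ψ x * (∑ j, x j * pd j u x)
      + dens a p u x * (∑ i, x i * pd i ψ x) + ∑ i : Fin N, dens a p u x * ψ x +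
        (u x ^ (p + 1) * ψ x * a * ‖x‖ ^ (a - 2)) * ∑ i, x i ^ 2 := by
      rw [Finset.mul_sum, Finset.mul_sum, Finset.mul_sum, ← Finset.sum_add_distrib,
        ← Finset.sum_add_distrib, ← Finset.sum_add_distrib]
      refine Finset.sum_congr rfl fun i _ => ?_
      simp only [d2, dens]
      ring
    have e2 : (u x ^ (p + 1) * ψ x * a * ‖x‖ ^ (a - 2)) * ∑ i, x i ^ 2
        = u x ^ (p + 1) * ψ x * (a * ‖x‖ ^ a) := by
      rw [← hxs]; ring
    rw [e1, e2]
    simp only [Finset.sum_const, Finset.card_univ, Fintype.card_fin, nsmul_eq_mul, dens]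
    ring
  have hl : lap u x = -(‖x‖ ^ a * u x ^ p) := by rw [← heq x]; ring
  rw [t1, t2, hl]
  field_simp
  ring

end sol

section final
variable {N : ℕ} {a p C R : ℝ} {u ψ : EuclideanSpace ℝ (Fin N) → ℝ}

lemma IsCut.smooth1 (h : IsCut C R ψ) : ContDiff ℝ 1 ψ := h.smooth.of_le (by norm_num)

lemma IsCut.gsq_le (h : IsCut C R ψ) (x : EuclideanSpace ℝ (Fin N)) :
    gsq ψ x ≤ (C / R) ^ 2 := sum_pd_sq_le ψ x (h.bound x)

lemma IsCut.pd_zero (h : IsCut C R ψ) {x : EuclideanSpace ℝ (Fin N)}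
    (hx : ¬ (R ≤ ‖x‖ ∧ ‖x‖ ≤ 2 * R)) (i : Fin N) : pd i ψ x = 0 := by
  apply pd_zero_of_fderiv
  by_cases h1 : R ≤ ‖x‖
  · exact h.d_out x (not_le.1 fun h2 => hx ⟨h1, h2⟩)
  · exact h.d_in x (not_le.1 h1)

lemma IsCut.gsq_zero (h : IsCut C R ψ) {x : EuclideanSpace ℝ (Fin N)}
    (hx : ¬ (R ≤ ‖x‖ ∧ ‖x‖ ≤ 2 * R)) : gsq ψ x = 0 :=
  Finset.sum_eq_zero fun i _ => by rw [h.pd_zero hx]; simp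

/-- The complement of the open ball. -/
def outs (N : ℕ) (R : ℝ) : Set (EuclideanSpace ℝ (Fin N)) := {x | R ≤ ‖x‖}

lemma outs_meas (R : ℝ) : MeasurableSet (outs N R) :=
  (isClosed_le continuous_const continuous_norm).measurableSet

/-- The constant on the ball of radius `2 * R`. -/
noncomputable def bfun (N : ℕ) (R c : ℝ) : EuclideanSpace ℝ (Fin N) → ℝ :=
  (Metric.closedBall 0 (2 * R)).indicator fun _ => c

lemma bfun_int (R c : ℝ) : Integrable (bfun N R c) := by
  unfold bfun
  rw [integrable_indicator_iff Metric.isClosed_closedBall.measurableSet]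
  exact integrableOn_const (by exact (isCompact_closedBall _ _).measure_lt_top.ne)

lemma bfun_integral (R c : ℝ) : ∫ x, bfun N R c x =
    c * (volume : Measure (EuclideanSpace ℝ (Fin N))).real (Metric.closedBall 0 (2 * R)) := by
  unfold bfun
  rw [integral_indicator Metric.isClosed_closedBall.measurableSet, setIntegral_const, smul_eq_mul,
    mul_comm]

lemma bfun_nonneg {R c : ℝ} (hc : 0 ≤ c) (x) : 0 ≤ bfun N R c x :=
  Set.indicator_nonneg (fun _ _ => hc) x

lemma bfun_eq {R c : ℝ} {x : EuclideanSpace ℝ (Fin N)} (hx : ‖x‖ ≤ 2 * R) : bfun N R c x = c := by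
  unfold bfun
  rw [Set.indicator_of_mem]
  simpa using hx

lemma cut_young (ha : 0 ≤ a) (hp : 1 < p) (hC : 0 < C) (hpos : ∀ x, 0 < u x) (hR : 0 < R)
    (h : IsCut C R ψ) (x : EuclideanSpace ℝ (Fin N)) :
    u x ^ 2 * gsq ψ x ≤ (outs N R).indicator (dens a p u) x +
      bfun N R (C ^ 2 * (C ^ 2) ^ (2 / (p - 1)) * R ^ (-(2 * (p + 1 + a) / (p - 1)))) x := by
  have hp1 : 0 < p - 1 := by linarith
  have hb : 0 ≤ C ^ 2 * (C ^ 2) ^ (2 / (p - 1)) * R ^ (-(2 * (p + 1 + a) / (p - 1))) := by positivity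
  by_cases hx : R ≤ ‖x‖ ∧ ‖x‖ ≤ 2 * R
  · rw [Set.indicator_of_mem (show x ∈ outs N R from hx.1), bfun_eq hx.2]
    obtain ⟨k, hk⟩ := exists_nat_ge (2 / (p - 1))
    rw [div_le_iff₀ hp1] at hk
    have := pointwise_young ha hp (A := C ^ 2) (by positivity) hk hR (hpos x) zero_le_one le_rfl hx.1
    have h2 : u x ^ 2 * gsq ψ x ≤ u x ^ 2 * (C / R) ^ 2 := by
      gcongr; exact h.gsq_le x
    simp only [one_pow, mul_one] at this
    refine (h2.trans_eq ?_).trans this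
    rw [div_eq_mul_inv]; ring
  · rw [h.gsq_zero hx, mul_zero]
    exact add_nonneg (Set.indicator_nonneg (fun x _ => dens_nonneg hpos x) x) (bfun_nonneg hb x)

lemma dens_integrable (hu : ContDiff ℝ 2 u) (ha : 0 ≤ a) (hp : 1 < p) (hpos : ∀ x, 0 < u x)
    (hθ : (N : ℝ) < 2 * (p + 1 + a) / (p - 1))
    (heq : ∀ x, -lap u x = ‖x‖ ^ a * u x ^ p) {K : Set (EuclideanSpace ℝ (Fin N))}
    (hK : IsCompact K)
    (hst : ∀ φ : EuclideanSpace ℝ (Fin N) → ℝ,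
            ContDiff ℝ 1 φ → HasCompactSupport φ → Disjoint (tsupport φ) K →
            0 ≤ (∫ x, ‖gradient φ x‖ ^ 2) - p * ∫ x, ‖x‖ ^ a * u x ^ (p - 1) * φ x ^ 2) :
    Integrable (dens a p u) := by
  have hu1 : ContDiff ℝ 1 u := hu.of_le (by norm_num)
  have hp1 : 0 < p - 1 := by linarith
  obtain ⟨C, hC, hcut⟩ := exists_cutoff N
  obtain ⟨R0, hR0, hKR⟩ : ∃ R0 : ℝ, 0 < R0 ∧ ∀ x ∈ K, ‖x‖ < R0 := by
    obtain ⟨r, hr⟩ := hK.isBounded.exists_norm_le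
    exact ⟨max r 0 + 1, by positivity, fun x hx =>
      lt_of_le_of_lt ((hr x hx).trans (le_max_left r 0)) (lt_add_one _)⟩
  obtain ⟨χ, hχ⟩ := hcut R0 hR0
  obtain ⟨k, hk⟩ := exists_nat_ge (2 / (p - 1))
  rw [div_le_iff₀ hp1] at hk
  set A : ℝ := 4 * (k + 1) ^ 2 * C ^ 2 / (p - 1) with hA
  have hApos : 0 < A := by positivity
  set B : ℝ := A * A ^ (2 / (p - 1)) with hB
  have hBpos : 0 < B := by positivity
  set θ : ℝ := 2 * (p + 1 + a) / (p - 1) with hθdef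
  have hcd : Continuous (dens a p u) := dens_cont ha hu1 hpos
  have iχ : Integrable (fun x => u x ^ 2 * gsq χ x) := by
    refine int_mul (hu1.continuous.pow 2) (gsq_cont hχ.smooth1) ?_
    refine (hχ.comp.fderiv ℝ).mono ?_
    intro x hx h0
    apply hx
    refine Finset.sum_eq_zero fun i _ => ?_
    rw [pd_zero_of_fderiv h0]; simp
  have hd0 := fun x => dens_nonneg (a := a) (p := p) hpos x
  -- the main bound
  have main : ∀ R : ℝ, 0 < R → ∫ x in Metric.closedBall 0 R, dens a p u x ≤
      (∫ x in Metric.closedBall 0 (2 * R0), dens a p u x) +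
      (4 / (p - 1) * (∫ x, u x ^ 2 * gsq χ x) + B * (R ^ (-θ) *
        (volume : Measure (EuclideanSpace ℝ (Fin N))).real (Metric.closedBall 0 (2 * R)))) := by
    intro R hR
    obtain ⟨ψ, hψ⟩ := hcut R hR
    have hdχ : ∀ x, DifferentiableAt ℝ χ x := fun x => (hχ.smooth1.differentiable (by norm_num)) x
    have hdψ : ∀ x, DifferentiableAt ℝ ψ x := fun x => (hψ.smooth1.differentiable (by norm_num)) x
    let η : EuclideanSpace ℝ (Fin N) → ℝ := fun x => (1 - χ x) * ψ x ^ (k + 1)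
    have hη : ContDiff ℝ 1 η := (contDiff_const.sub hχ.smooth1).mul (hψ.smooth1.pow _)
    have hψk : HasCompactSupport (fun x => ψ x ^ (k + 1)) := by
      refine hψ.comp.mono fun x hx h0 => hx ?_
      simp [h0]
    have hηs : HasCompactSupport η := hψk.mul_left
    have hηK : Disjoint (tsupport η) K := by
      have : tsupport η ⊆ outs N R0 := by
        refine closure_minimal ?_ (isClosed_le continuous_const continuous_norm)
        intro x hx
        by_contra h
        have h' : ‖x‖ < R0 := not_le.1 h
        apply hx
        simp [η, hχ.one x h'.le]
      rw [Set.disjoint_left]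
      intro x hx hxK
      have h1 : R0 ≤ ‖x‖ := this hx
      linarith [hKR x hxK]
    have hηs2 : HasCompactSupport (fun x => η x ^ 2) := by
      refine hηs.mono fun x hx h0 => hx ?_
      simp [h0]
    have hst2 := stable_ineq hu ha hpos heq hst hη hηs hηK
    have id : Integrable (fun x => dens a p u x * η x ^ 2) :=
      int_mul hcd (hη.continuous.pow 2) hηs2
    have pw : ∀ x, u x ^ 2 * gsq η x ≤ 2 * (u x ^ 2 * gsq χ x) +
        (p - 1) / 2 * (dens a p u x * η x ^ 2 + bfun N R (B * R ^ (-θ)) x) := by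
      intro x
      have q1 : ∀ i, pd i η x = -pd i χ x * ψ x ^ (k + 1) +
          (1 - χ x) * ((k + 1) * ψ x ^ k * pd i ψ x) := fun i => by
        refine HasPD.pd_eq ((hη.differentiable (by norm_num)) x) ?_
        have h1 : HasPD i (fun x => 1 - χ x) (-pd i χ x) x :=
          HasDerivAt.const_sub 1 (HasPD.of_diff (hdχ x))
        have h2 : HasPD i (fun x => ψ x ^ (k + 1)) ((k + 1) * ψ x ^ k * pd i ψ x) x := by
          have := HasDerivAt.fun_pow (HasPD.of_diff (i := i) (hdψ x)) (k + 1)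
          simpa [HasPD, HasLineDerivAt] using this
        exact h1.mul h2
      have q2 : gsq η x ≤ 2 * gsq χ x + 2 * (1 - χ x) ^ 2 * (k + 1) ^ 2 * ψ x ^ (2 * k) * gsq ψ x := by
        unfold gsq
        rw [Finset.mul_sum, Finset.mul_sum, ← Finset.sum_add_distrib]
        refine Finset.sum_le_sum fun i _ => ?_
        rw [q1]
        have h1 : (pd i χ x * ψ x ^ (k + 1)) ^ 2 ≤ pd i χ x ^ 2 := by
          rw [mul_pow]
          refine mul_le_of_le_one_right (sq_nonneg _) ?_
          exact pow_le_one₀ (pow_nonneg (hψ.nonneg x) _) (pow_le_one₀ (hψ.nonneg x) (hψ.le_one x))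
        have h2 : ψ x ^ (2 * k) = (ψ x ^ k) ^ 2 := by rw [mul_comm, pow_mul]
        rw [h2]
        nlinarith [sq_nonneg (-pd i χ x * ψ x ^ (k + 1) - (1 - χ x) * ((k + 1) * ψ x ^ k * pd i ψ x))]
      have q3 : u x ^ 2 * (2 * (1 - χ x) ^ 2 * (k + 1) ^ 2 * ψ x ^ (2 * k) * gsq ψ x) ≤
          (p - 1) / 2 * (dens a p u x * η x ^ 2 + bfun N R (B * R ^ (-θ)) x) := by
        by_cases hx : R ≤ ‖x‖ ∧ ‖x‖ ≤ 2 * R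
        · rw [bfun_eq hx.2]
          have y := pointwise_young ha hp hApos hk hR (hpos x) (hψ.nonneg x) (hψ.le_one x) hx.1
          have hχ1 : (1 - χ x) ^ 2 ≤ 1 := by
            have := hχ.nonneg x
            have := hχ.le_one x
            exact pow_le_one₀ (by linarith) (by linarith)
          have y2 := mul_le_mul_of_nonneg_left y (sq_nonneg (1 - χ x))
          have hψ0 := hψ.nonneg x
          calc _ ≤ u x ^ 2 * (2 * (1 - χ x) ^ 2 * (k + 1) ^ 2 * ψ x ^ (2 * k) * (C / R) ^ 2) := by
                gcongr; exact hψ.gsq_le x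
            _ = (p - 1) / 2 * ((1 - χ x) ^ 2 * (A * R⁻¹ ^ 2 * u x ^ 2 * ψ x ^ (2 * k))) := by
                rw [hA]; field_simp; ring
            _ ≤ (p - 1) / 2 * ((1 - χ x) ^ 2 * (‖x‖ ^ a * u x ^ (p + 1) * ψ x ^ (2 * (k + 1)) +
                  B * R ^ (-θ))) := by gcongr
            _ ≤ _ := by
                have e : dens a p u x * η x ^ 2 =
                    (1 - χ x) ^ 2 * (‖x‖ ^ a * u x ^ (p + 1) * ψ x ^ (2 * (k + 1))) := by
                  simp only [dens, η]; ring
                rw [e, mul_add ((1 - χ x) ^ 2)]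
                have hb : (1 - χ x) ^ 2 * (B * R ^ (-θ)) ≤ B * R ^ (-θ) :=
                  mul_le_of_le_one_left (by positivity) hχ1
                exact mul_le_mul_of_nonneg_left (by linarith) (by positivity)
        · rw [hψ.gsq_zero hx]
          have h1 := hd0 x
          have h2 := bfun_nonneg (N := N) (R := R) (c := B * R ^ (-θ)) (by positivity) x
          have : 0 ≤ (p - 1) / 2 * (dens a p u x * η x ^ 2 + bfun N R (B * R ^ (-θ)) x) := by
            positivity
          simpa using this
      calc u x ^ 2 * gsq η x ≤ u x ^ 2 * (2 * gsq χ x +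
            2 * (1 - χ x) ^ 2 * (k + 1) ^ 2 * ψ x ^ (2 * k) * gsq ψ x) := by gcongr
        _ ≤ _ := by rw [mul_add]; linarith
    have ib := bfun_int (N := N) R (B * R ^ (-θ))
    have idb : Integrable (fun x => dens a p u x * η x ^ 2 + bfun N R (B * R ^ (-θ)) x) := id.add ib
    have hle : ∫ x, u x ^ 2 * gsq η x ≤ 2 * (∫ x, u x ^ 2 * gsq χ x) +
        (p - 1) / 2 * ((∫ x, dens a p u x * η x ^ 2) + ∫ x, bfun N R (B * R ^ (-θ)) x) := by
      rw [← integral_add id ib, ← integral_const_mul, ← integral_const_mul,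
        ← integral_add (iχ.const_mul 2) (idb.const_mul _)]
      refine integral_mono_of_nonneg (Filter.Eventually.of_forall fun x => ?_)
        ((iχ.const_mul 2).add (idb.const_mul _)) (Filter.Eventually.of_forall pw)
      exact mul_nonneg (sq_nonneg _) (gsq_nonneg x)
    rw [bfun_integral] at hle
    have hfin : ∫ x, dens a p u x * η x ^ 2 ≤ 4 / (p - 1) * (∫ x, u x ^ 2 * gsq χ x) +
        B * (R ^ (-θ) *
        (volume : Measure (EuclideanSpace ℝ (Fin N))).real (Metric.closedBall 0 (2 * R))) := by
      set I := ∫ x, dens a p u x * η x ^ 2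
      set J := ∫ x, u x ^ 2 * gsq χ x
      set V := (volume : Measure (EuclideanSpace ℝ (Fin N))).real (Metric.closedBall 0 (2 * R))
      have h1 : (p - 1) / 2 * I ≤ 2 * J + (p - 1) / 2 * (B * R ^ (-θ) * V) := by linarith
      have h2 : (p - 1) / 2 * I ≤ (p - 1) / 2 * (4 / (p - 1) * J + B * (R ^ (-θ) * V)) := by
        refine h1.trans_eq ?_
        field_simp
        ring
      exact le_of_mul_le_mul_left h2 (by positivity)
    refine le_trans ?_ (add_le_add_right hfin _)
    rw [← integral_indicator Metric.isClosed_closedBall.measurableSet,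
      ← integral_indicator Metric.isClosed_closedBall.measurableSet]
    have i1 : ∀ r : ℝ, Integrable ((Metric.closedBall 0 r).indicator (dens a p u)) := fun r =>
      (integrable_indicator_iff Metric.isClosed_closedBall.measurableSet).2
        (hcd.continuousOn.integrableOn_compact (isCompact_closedBall _ _))
    rw [← integral_add (i1 _) id]
    refine integral_mono (i1 _) ((i1 _).add id) fun x => ?_
    have n1 : 0 ≤ (Metric.closedBall 0 (2 * R0)).indicator (dens a p u) x :=
      Set.indicator_nonneg (fun x _ => hd0 x) x
    have n2 : 0 ≤ dens a p u x * η x ^ 2 := mul_nonneg (hd0 x) (sq_nonneg _)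
    by_cases hx : ‖x‖ ≤ R
    · rw [Set.indicator_of_mem (by simpa using hx)]
      by_cases hx2 : ‖x‖ ≤ 2 * R0
      · rw [Set.indicator_of_mem (by simpa using hx2)]
        linarith
      · have : η x = 1 := by simp [η, hψ.one x hx, hχ.zero x (not_le.1 hx2).le]
        rw [this] at n2 ⊢
        linarith
    · rw [Set.indicator_of_notMem (by simpa using hx)]
      positivity
  have hT := vol_decay (N := N) hθ
  have hev : ∀ᶠ n : ℕ in Filter.atTop, ((n : ℝ) + 1) ^ (-θ) *
      (volume : Measure (EuclideanSpace ℝ (Fin N))).real (Metric.closedBall 0 (2 * ((n : ℝ) + 1))) ≤ 1 :=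
    (hT.eventually (gt_mem_nhds zero_lt_one)).mono fun n h => h.le
  refine (aecover_closedBall (x := (0 : EuclideanSpace ℝ (Fin N))) (l := Filter.atTop)
    (r := fun n : ℕ => (n : ℝ) + 1)
    (Filter.tendsto_atTop_add_const_right _ _ tendsto_natCast_atTop_atTop)
    ).integrable_of_integral_bounded_of_nonneg_ae
    ((∫ x in Metric.closedBall 0 (2 * R0), dens a p u x) +
      (4 / (p - 1) * (∫ x, u x ^ 2 * gsq χ x) + B * 1)) ?_ (Filter.Eventually.of_forall hd0) ?_
  · exact fun n => hcd.continuousOn.integrableOn_compact (isCompact_closedBall _ _)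
  · filter_upwards [hev] with n hn
    refine (main _ (by positivity)).trans ?_
    gcongr

lemma gsq_integrable (hu : ContDiff ℝ 2 u) (ha : 0 ≤ a) (hp : 1 < p) (hpos : ∀ x, 0 < u x)
    (hθ : (N : ℝ) < 2 * (p + 1 + a) / (p - 1))
    (heq : ∀ x, -lap u x = ‖x‖ ^ a * u x ^ p) (hdi : Integrable (dens a p u)) :
    Integrable (gsq u) := by
  have hu1 : ContDiff ℝ 1 u := hu.of_le (by norm_num)
  have hp1 : 0 < p - 1 := by linarith
  obtain ⟨C, hC, hcut⟩ := exists_cutoff N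
  set B : ℝ := C ^ 2 * (C ^ 2) ^ (2 / (p - 1)) with hB
  have hBpos : 0 < B := by positivity
  set θ : ℝ := 2 * (p + 1 + a) / (p - 1) with hθdef
  have hcg : Continuous (gsq u) := gsq_cont hu1
  have hd0 := fun x => dens_nonneg (a := a) (p := p) hpos x
  have main : ∀ R : ℝ, 0 < R → ∫ x in Metric.closedBall 0 R, gsq u x ≤
      6 * (∫ x, dens a p u x) + 4 * (B * (R ^ (-θ) *
        (volume : Measure (EuclideanSpace ℝ (Fin N))).real (Metric.closedBall 0 (2 * R)))) := by
    intro R hR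
    obtain ⟨ψ, hψ⟩ := hcut R hR
    have hdψ : ∀ x, DifferentiableAt ℝ ψ x := fun x => (hψ.smooth1.differentiable (by norm_num)) x
    have hs2 : HasCompactSupport (fun x => ψ x ^ 2) := by
      refine hψ.comp.mono fun x hx h0 => hx ?_
      simp [h0]
    obtain ⟨i1, h1⟩ := energy hu hpos heq (hψ.smooth1.pow 2) hs2
    have ib := bfun_int (N := N) R (B * R ^ (-θ))
    have ig : Integrable ((Metric.closedBall 0 R).indicator (gsq u)) :=
      (integrable_indicator_iff Metric.isClosed_closedBall.measurableSet).2
        (hcg.continuousOn.integrableOn_compact (isCompact_closedBall _ _))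
    rw [← integral_indicator Metric.isClosed_closedBall.measurableSet]
    have pw : ∀ x, (Metric.closedBall 0 R).indicator (gsq u) x ≤
        2 * (gsq u x * ψ x ^ 2 - dens a p u x * ψ x ^ 2 +
          u x * ∑ i, pd i u x * pd i (fun x => ψ x ^ 2) x) +
        (6 * dens a p u x + 4 * bfun N R (B * R ^ (-θ)) x) := by
      intro x
      have y := cut_young ha hp hC hpos hR hψ x
      have y2 : (outs N R).indicator (dens a p u) x ≤ dens a p u x :=
        Set.indicator_le_self' (fun _ _ => hd0 x) x
      have q2 : ∀ i, pd i (fun x => ψ x ^ 2) x = 2 * ψ x * pd i ψ x := fun i => by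
        have := ((HasPD.of_diff (i := i) (hdψ x)).mul (HasPD.of_diff (hdψ x)))
        have h3 : pd i (fun x => ψ x ^ 2) x = pd i ψ x * ψ x + ψ x * pd i ψ x := by
          refine HasPD.pd_eq ((hdψ x).pow 2) ?_
          simpa [sq] using this
        rw [h3]; ring
      have e : u x * ∑ i, pd i u x * pd i (fun x => ψ x ^ 2) x
          = ∑ i, 2 * (pd i u x * ψ x) * (u x * pd i ψ x) := by
        rw [Finset.mul_sum]
        refine Finset.sum_congr rfl fun i _ => ?_
        rw [q2]; ring
      have e2 : -(1 / 2) * (gsq u x * ψ x ^ 2) - 2 * (u x ^ 2 * gsq ψ x) ≤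
          ∑ i, 2 * (pd i u x * ψ x) * (u x * pd i ψ x) := by
        unfold gsq
        rw [Finset.mul_sum, Finset.sum_mul, Finset.mul_sum, Finset.mul_sum,
          ← Finset.sum_sub_distrib]
        refine Finset.sum_le_sum fun i _ => ?_
        nlinarith [sq_nonneg (pd i u x * ψ x + 2 * (u x * pd i ψ x))]
      have e3 : dens a p u x * ψ x ^ 2 ≤ dens a p u x :=
        mul_le_of_le_one_right (hd0 x) (pow_le_one₀ (hψ.nonneg x) (hψ.le_one x))
      have e4 : (Metric.closedBall 0 R).indicator (gsq u) x ≤ gsq u x * ψ x ^ 2 := by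
        by_cases hx : ‖x‖ ≤ R
        · rw [Set.indicator_of_mem (by simpa using hx), hψ.one x hx]; simp
        · rw [Set.indicator_of_notMem (by simpa using hx)]
          exact mul_nonneg (gsq_nonneg x) (sq_nonneg _)
      rw [e]
      linarith
    have ir : Integrable (fun x => 6 * dens a p u x + 4 * bfun N R (B * R ^ (-θ)) x) :=
      (hdi.const_mul 6).add (ib.const_mul 4)
    refine (integral_mono ig ((i1.const_mul 2).add ir) pw).trans_eq ?_
    rw [integral_add' (i1.const_mul 2) ir, integral_const_mul, h1,
      integral_add (hdi.const_mul 6) (ib.const_mul 4), integral_const_mul, integral_const_mul,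
      bfun_integral]
    ring
  have hT := vol_decay (N := N) hθ
  have hev : ∀ᶠ n : ℕ in Filter.atTop, ((n : ℝ) + 1) ^ (-θ) *
      (volume : Measure (EuclideanSpace ℝ (Fin N))).real (Metric.closedBall 0 (2 * ((n : ℝ) + 1))) ≤ 1 :=
    (hT.eventually (gt_mem_nhds zero_lt_one)).mono fun n h => h.le
  refine (aecover_closedBall (x := (0 : EuclideanSpace ℝ (Fin N))) (l := Filter.atTop)
    (r := fun n : ℕ => (n : ℝ) + 1)
    (Filter.tendsto_atTop_add_const_right _ _ tendsto_natCast_atTop_atTop)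
    ).integrable_of_integral_bounded_of_nonneg_ae
    (6 * (∫ x, dens a p u x) + 4 * (B * 1)) ?_ (Filter.Eventually.of_forall fun x => gsq_nonneg x) ?_
  · exact fun n => hcg.continuousOn.integrableOn_compact (isCompact_closedBall _ _)
  · filter_upwards [hev] with n hn
    refine (main _ (by positivity)).trans ?_
    gcongr

lemma tail_tendsto {f : EuclideanSpace ℝ (Fin N) → ℝ} (hf : Integrable f) :
    Filter.Tendsto (fun n : ℕ => ∫ x, (outs N ((n : ℝ) + 1)).indicator f x) Filter.atTop (nhds 0) := by
  simp_rw [integral_indicator (outs_meas _)]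
  have := tendsto_setIntegral_of_antitone (μ := volume) (f := f)
    (s := fun n : ℕ => outs N ((n : ℝ) + 1))
    (fun n => outs_meas _) ?_ ⟨0, hf.integrableOn⟩
  · have he : ⋂ n : ℕ, outs N ((n : ℝ) + 1) = ∅ := by
      ext x
      simp only [Set.mem_iInter, Set.mem_empty_iff_false, iff_false, not_forall]
      obtain ⟨n, hn⟩ := exists_nat_ge ‖x‖
      refine ⟨n, fun h => ?_⟩
      have h : (n : ℝ) + 1 ≤ ‖x‖ := h
      linarith
    rw [he] at this
    simpa using this
  · intro m n hmn x hx
    have hx : (n : ℝ) + 1 ≤ ‖x‖ := hx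
    have : (m : ℝ) ≤ n := by exact_mod_cast hmn
    show (m : ℝ) + 1 ≤ ‖x‖
    linarith

lemma combined (hN : 3 ≤ N) (hu : ContDiff ℝ 2 u) (ha : 0 ≤ a) (hp : 1 < p) (hpos : ∀ x, 0 < u x)
    (heq : ∀ x, -lap u x = ‖x‖ ^ a * u x ^ p) (hdi : Integrable (dens a p u))
    (hgi : Integrable (gsq u)) (hC : 0 < C) (hR : 0 < R) (hψ : IsCut C R ψ) :
    ((N + a) / (p + 1) - (N / 2 - 1)) * ∫ x, dens a p u x * ψ x ≤
      (N + 4 * C) * (∫ x, (outs N R).indicator (fun x => gsq u x + dens a p u x) x) +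
      N * (C ^ 2 * (C ^ 2) ^ (2 / (p - 1)) * (R ^ (-(2 * (p + 1 + a) / (p - 1))) *
        (volume : Measure (EuclideanSpace ℝ (Fin N))).real (Metric.closedBall 0 (2 * R)))) := by
  have hu1 : ContDiff ℝ 1 u := hu.of_le (by norm_num)
  have hp1 : 0 < p - 1 := by linarith
  have hN' : (3:ℝ) ≤ N := by exact_mod_cast hN
  set θ : ℝ := 2 * (p + 1 + a) / (p - 1) with hθdef
  set B : ℝ := C ^ 2 * (C ^ 2) ^ (2 / (p - 1)) with hB
  have hBpos : 0 < B := by positivity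
  have hd0 := fun x => dens_nonneg (a := a) (p := p) hpos x
  obtain ⟨i1, h1⟩ := energy hu hpos heq hψ.smooth1 hψ.comp
  obtain ⟨i2, h2⟩ := pohozaev hu ha hp hpos heq hψ.smooth1 hψ.comp
  have id : Integrable (fun x => dens a p u x * ψ x) :=
    int_mul (dens_cont ha hu1 hpos) hψ.smooth1.continuous hψ.comp
  have ih : Integrable ((outs N R).indicator (fun x => gsq u x + dens a p u x)) :=
    (hgi.add hdi).indicator (outs_meas R)
  have ib := bfun_int (N := N) R (B * R ^ (-θ))
  have pw : ∀ x, ((N + a) / (p + 1) - (N / 2 - 1)) * (dens a p u x * ψ x) ≤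
      ((N / 2 - 1) * (gsq u x * ψ x - dens a p u x * ψ x + u x * ∑ i, pd i u x * pd i ψ x) +
      ((((1 - N / 2) * gsq u x + (N + a) / (p + 1) * dens a p u x) * ψ x +
      ((∑ j, x j * pd j u x) * (∑ i, pd i u x * pd i ψ x) +
        (1 / (p + 1) * dens a p u x - 1 / 2 * gsq u x) * ∑ i, x i * pd i ψ x)))) +
      ((N + 4 * C) * (outs N R).indicator (fun x => gsq u x + dens a p u x) x
        + N * bfun N R (B * R ^ (-θ)) x) := by
    intro x
    have hg0 : 0 ≤ gsq u x := gsq_nonneg x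
    have hdx := hd0 x
    have hI : 0 ≤ (outs N R).indicator (fun x => gsq u x + dens a p u x) x :=
      Set.indicator_nonneg (fun x _ => add_nonneg (gsq_nonneg x) (hd0 x)) x
    have hb0 := bfun_nonneg (N := N) (R := R) (c := B * R ^ (-θ)) (by positivity) x
    suffices hs : 0 ≤ (N / 2 - 1) * (u x * ∑ i, pd i u x * pd i ψ x) +
        ((∑ j, x j * pd j u x) * (∑ i, pd i u x * pd i ψ x) +
        (1 / (p + 1) * dens a p u x - 1 / 2 * gsq u x) * ∑ i, x i * pd i ψ x) +
        ((N + 4 * C) * (outs N R).indicator (fun x => gsq u x + dens a p u x) x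
        + N * bfun N R (B * R ^ (-θ)) x) by
      linarith
    by_cases hx : R ≤ ‖x‖ ∧ ‖x‖ ≤ 2 * R
    · have y := cut_young ha hp hC hpos hR hψ x
      rw [Set.indicator_of_mem (show x ∈ outs N R from hx.1)] at y ⊢
      set b := bfun N R (B * R ^ (-θ)) x
      set G := gsq u x
      set D := dens a p u x
      set P := ∑ i, pd i u x * pd i ψ x with hP
      set S := ∑ j, x j * pd j u x with hS
      set X := ∑ i, x i * pd i ψ x with hX
      have hP2 : P ^ 2 ≤ G * gsq ψ x := cs_pd u ψ x
      have hS2 : S ^ 2 ≤ ‖x‖ ^ 2 * G := by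
        rw [EuclideanSpace.real_norm_sq_eq]
        exact Finset.sum_mul_sq_le_sq_mul_sq _ _ _
      have hX2 : X ^ 2 ≤ ‖x‖ ^ 2 * gsq ψ x := by
        rw [EuclideanSpace.real_norm_sq_eq]
        exact Finset.sum_mul_sq_le_sq_mul_sq _ _ _
      have hgψ := hψ.gsq_le x
      have hgψ0 : 0 ≤ gsq ψ x := gsq_nonneg x
      have hxn : ‖x‖ ^ 2 ≤ (2 * R) ^ 2 := by gcongr; exact hx.2
      have hxg : ‖x‖ ^ 2 * gsq ψ x ≤ (2 * C) ^ 2 := by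
        calc ‖x‖ ^ 2 * gsq ψ x ≤ (2 * R) ^ 2 * (C / R) ^ 2 := by gcongr
          _ = _ := by field_simp
      have hXb : |X| ≤ 2 * C := abs_le_of_sq_le_sq (hX2.trans hxg) (by positivity)
      have hSP : |S * P| ≤ 2 * C * G := by
        refine abs_le_of_sq_le_sq ?_ (by positivity)
        calc (S * P) ^ 2 = S ^ 2 * P ^ 2 := by ring
          _ ≤ (‖x‖ ^ 2 * G) * (G * gsq ψ x) := by gcongr
          _ = (‖x‖ ^ 2 * gsq ψ x) * G ^ 2 := by ring
          _ ≤ (2 * C) ^ 2 * G ^ 2 := by gcongr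
          _ = _ := by ring
      have huP : |u x * P| ≤ G + (D + b) := by
        refine abs_le_of_sq_le_sq ?_ (by positivity)
        calc (u x * P) ^ 2 = u x ^ 2 * P ^ 2 := by ring
          _ ≤ u x ^ 2 * (G * gsq ψ x) := by gcongr
          _ = G * (u x ^ 2 * gsq ψ x) := by ring
          _ ≤ G * (D + b) := by gcongr
          _ ≤ _ := by nlinarith [sq_nonneg (G - (D + b)), mul_nonneg hg0 (add_nonneg hdx hb0)]
      have hDG : |1 / (p + 1) * D - 1 / 2 * G| ≤ D + G := by
        have hq : 1 / (p + 1) ≤ 1 := by rw [div_le_one (by linarith)]; linarith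
        have hq0 : 0 ≤ 1 / (p + 1) := by positivity
        have h3 : 1 / (p + 1) * D ≤ D := mul_le_of_le_one_left hdx hq
        have h4 : 0 ≤ 1 / (p + 1) * D := by positivity
        rw [abs_le]
        constructor <;> linarith
      have hDX : |(1 / (p + 1) * D - 1 / 2 * G) * X| ≤ (D + G) * (2 * C) := by
        rw [abs_mul]; gcongr
      have k1 := neg_le_of_abs_le hSP
      have k2 := neg_le_of_abs_le hDX
      have k3 := neg_le_of_abs_le huP
      have k4 : (N / 2 - 1 : ℝ) * (-(G + (D + b))) ≤ (N / 2 - 1) * (u x * P) :=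
        mul_le_mul_of_nonneg_left k3 (by linarith)
      have k5 : 0 ≤ G + (D + b) := by positivity
      nlinarith [mul_nonneg hC.le hdx, mul_nonneg hC.le hg0, mul_nonneg (show (0:ℝ) ≤ N by linarith) k5]
    · have hz := fun i => hψ.pd_zero hx i
      simp only [hz, mul_zero, Finset.sum_const_zero, zero_add]
      positivity
  have i12 := (i1.const_mul (N / 2 - 1 : ℝ)).add i2
  have i34 : Integrable (fun x => (N + 4 * C) * (outs N R).indicator (fun x => gsq u x + dens a p u x) x
        + N * bfun N R (B * R ^ (-θ)) x) := (ih.const_mul _).add (ib.const_mul _)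
  rw [← integral_const_mul]
  refine (integral_mono (id.const_mul _) (i12.add i34) pw).trans_eq ?_
  rw [integral_add' i12 i34, integral_add' (i1.const_mul _) i2, integral_const_mul, h1, h2,
    integral_add (ih.const_mul _) (ib.const_mul _), integral_const_mul, integral_const_mul,
    bfun_integral]
  ring

end final

/-- **No finite-Morse-index positive solution of the Hénon equation below the critical
exponent.** If `a ≥ 0`, `N ≥ 3` and `1 < p < (N+2+2a)/(N-2)`, then `-Δu = |x|^a u^p` on `ℝ^N`
has no positive `C²` solution which is stable outside some compact set `Σ`, i.e. such that
`∫ |∇φ|² - p ∫ |x|^a u^(p-1) φ² ≥ 0` for every `C¹` test function `φ` compactly supported in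
`ℝ^N ∖ Σ`.  (Every solution of finite Morse index is stable outside a compact set.) -/
theorem henon_no_finite_morse_index_positive_solution
    (N : ℕ) (hN : 3 ≤ N) (a p : ℝ) (ha : 0 ≤ a) (hp : 1 < p)
    (hsub : p < ((N : ℝ) + 2 + 2 * a) / ((N : ℝ) - 2)) :
    ¬ ∃ u : EuclideanSpace ℝ (Fin N) → ℝ,
        ContDiff ℝ 2 u ∧ (∀ x, 0 < u x) ∧
        (∀ x, -lap u x = ‖x‖ ^ a * u x ^ p) ∧
        (∃ K : Set (EuclideanSpace ℝ (Fin N)), IsCompact K ∧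
          ∀ φ : EuclideanSpace ℝ (Fin N) → ℝ,
            ContDiff ℝ 1 φ → HasCompactSupport φ → Disjoint (tsupport φ) K →
            0 ≤ (∫ x, ‖gradient φ x‖ ^ 2) - p * ∫ x, ‖x‖ ^ a * u x ^ (p - 1) * φ x ^ 2) := by
  rintro ⟨u, hu, hpos, heq, K, hK, hst⟩
  have hN' : (3:ℝ) ≤ N := by exact_mod_cast hN
  have hp1 : 0 < p - 1 := by linarith
  have hu1 : ContDiff ℝ 1 u := hu.of_le (by norm_num)
  rw [lt_div_iff₀ (by linarith)] at hsub
  have hθ : (N : ℝ) < 2 * (p + 1 + a) / (p - 1) := by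
    rw [lt_div_iff₀ hp1]; linarith
  have hdi := dens_integrable hu ha hp hpos hθ heq hK hst
  have hgi := gsq_integrable hu ha hp hpos hθ heq hdi
  obtain ⟨C, hC, hcut⟩ := exists_cutoff N
  have hκ : 0 < ((N + a) / (p + 1) - (N / 2 - 1) : ℝ) := by
    rw [sub_pos, lt_div_iff₀ (by linarith)]
    linarith
  obtain ⟨χ, hχ⟩ := hcut (1 / 2) (by norm_num)
  have hcd : Continuous (dens a p u) := dens_cont ha hu1 hpos
  have iχ : Integrable (fun x => dens a p u x * χ x) := int_mul hcd hχ.smooth1.continuous hχ.comp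
  have hδ : 0 < ∫ x, dens a p u x * χ x := by
    let x0 : EuclideanSpace ℝ (Fin N) := EuclideanSpace.single ⟨0, by lia⟩ (1 / 2)
    have hx0 : ‖x0‖ = 1 / 2 := by simp [x0]
    refine Continuous.integral_pos_of_hasCompactSupport_nonneg_nonzero (x := x0)
      (hcd.mul hχ.smooth1.continuous) hχ.comp.mul_left
      (fun x => mul_nonneg (dens_nonneg hpos x) (hχ.nonneg x)) ?_
    rw [hχ.one x0 hx0.le, dens, hx0]
    have := hpos x0
    positivity
  have hlim := ((tail_tendsto (hgi.add hdi)).const_mul (N + 4 * C)).add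
    (((vol_decay hθ).const_mul (C ^ 2 * (C ^ 2) ^ (2 / (p - 1)))).const_mul (N : ℝ))
  simp only [mul_zero, add_zero] at hlim
  have hle : ((N + a) / (p + 1) - (N / 2 - 1) : ℝ) * (∫ x, dens a p u x * χ x) ≤ 0 := by
    refine ge_of_tendsto' hlim fun n => ?_
    have hR : (0:ℝ) < n + 1 := by positivity
    obtain ⟨ψ, hψ⟩ := hcut _ hR
    refine le_trans ?_ (combined hN hu ha hp hpos heq hdi hgi hC hR hψ)
    refine mul_le_mul_of_nonneg_left ?_ hκ.le
    refine integral_mono iχ (int_mul hcd hψ.smooth1.continuous hψ.comp) fun x => ?_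
    refine mul_le_mul_of_nonneg_left ?_ (dens_nonneg hpos x)
    by_cases hx : ‖x‖ ≤ 1
    · rw [hψ.one x (hx.trans (by simp))]
      exact hχ.le_one x
    · rw [hχ.zero x (by linarith [not_le.1 hx])]
      exact hψ.nonneg x
  exact absurd hle (not_le.2 (mul_pos hκ hδ))
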